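/- arXiv:2409.11091 — 3 statements merged into one kernel-verified Lean document; each statement's English description precedes it below -/
import Mathlib

section
/- For every profile v = (v_1,…,v_n) of XOS valuations, the welfare Ĝ(v) of the allocation output by the modified buyer-wise greedy algorithm with powers-of-two prices is at least one third of the optimal offline welfare: OPT(v) ≤ 3·Ĝ(v). -/
open scoped BigOperators

/-- A valuation is a real-valued set function on bundles of the `m` items. -/
abbrev Val (m : ℕ) := Finset (Fin m) → ℝ

/-- A (normalized, monotone) valuation. -/
def IsValuation {m : ℕ} (v : Val m) : Prop :=
  v ∅ = 0 ∧ ∀ A B : Finset (Fin m), A ⊆ B → v A ≤ v B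

/-- XOS (fractionally subadditive) valuations: a pointwise maximum of finitely many
nonnegative additive functions. -/
def IsXOS {m : ℕ} (v : Val m) : Prop :=
  ∃ (k : ℕ) (a : Fin (k + 1) → Fin m → ℝ),
    (∀ ℓ j, 0 ≤ a ℓ j) ∧ ∀ B : Finset (Fin m), v B = ⨆ ℓ, ∑ j ∈ B, a ℓ j

/-- An allocation: pairwise disjoint bundles. -/
def IsAlloc {n m : ℕ} (A : Fin n → Finset (Fin m)) : Prop :=
  ∀ i i' : Fin n, i ≠ i' → Disjoint (A i) (A i')

/-- The optimal offline welfare of a valuation profile. -/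
noncomputable def OPT {n m : ℕ} (v : Fin n → Val m) : ℝ :=
  ⨆ A : {A : Fin n → Finset (Fin m) // IsAlloc A}, ∑ i, v i (A.1 i)

/-- `B` is a demand set of valuation `v` at prices `p` among the available items `M`:
it maximizes the utility `v(B) - Σ_{j ∈ B} p j` over subsets of `M`. -/
def IsDemand {m : ℕ} (v : Val m) (p : Fin m → ℝ) (M : Finset (Fin m))
    (B : Finset (Fin m)) : Prop :=
  B ⊆ M ∧ ∀ B' ⊆ M, v B' - ∑ j ∈ B', p j ≤ v B - ∑ j ∈ B, p j

/-- `a` is an additive supporting function of `v` on `B`. -/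
def IsSupport {m : ℕ} (v : Val m) (B : Finset (Fin m)) (a : Fin m → ℝ) : Prop :=
  (∀ j, 0 ≤ a j) ∧ (∀ j, j ∉ B → a j = 0) ∧
  (∀ B' : Finset (Fin m), ∑ j ∈ B', a j ≤ v B') ∧ ∑ j ∈ B, a j = v B

/-- The least power of two that is at least `x` (by convention `0` for `x ≤ 0`). -/
noncomputable def pow2ceil (x : ℝ) : ℝ :=
  if x ≤ 0 then 0 else (2 : ℝ) ^ (⌈Real.logb 2 x⌉ : ℤ)

theorem le_pow2ceil (x : ℝ) : x ≤ pow2ceil x := by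
  unfold pow2ceil
  split_ifs with h
  · exact h
  · push Not at h
    calc x = (2 : ℝ) ^ Real.logb 2 x := (Real.rpow_logb (by norm_num) (by norm_num) h).symm
      _ ≤ (2 : ℝ) ^ ((⌈Real.logb 2 x⌉ : ℤ) : ℝ) :=
        Real.rpow_le_rpow_of_exponent_le (by norm_num) (Int.le_ceil _)
      _ = _ := Real.rpow_intCast _ _

theorem pow2ceil_le_two_mul {x : ℝ} (hx : 0 ≤ x) : pow2ceil x ≤ 2 * x := by
  unfold pow2ceil
  split_ifs with h
  · positivity
  · push Not at h
    calc (2 : ℝ) ^ (⌈Real.logb 2 x⌉ : ℤ) = (2 : ℝ) ^ ((⌈Real.logb 2 x⌉ : ℤ) : ℝ) :=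
        (Real.rpow_intCast _ _).symm
      _ ≤ (2 : ℝ) ^ (Real.logb 2 x + 1) :=
        Real.rpow_le_rpow_of_exponent_le (by norm_num) (Int.ceil_lt_add_one _).le
      _ = 2 * x := by
        rw [Real.rpow_add (by norm_num), Real.rpow_logb (by norm_num) (by norm_num) h,
          Real.rpow_one, mul_comm]

/-- Price history of a single item: `S i` says that step `i` takes the item with supporting
value `x i` and resets its price to `q i`. The final price and the telescoping sum of the
surpluses are controlled by the supporting value at the last step taking the item. -/
theorem price_history_bounds {n : ℕ} (S : Fin n → Prop) [DecidablePred S] (x q : Fin n → ℝ)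
    (p : Fin (n + 1) → ℝ) (hp0 : p 0 = 0)
    (hp : ∀ i : Fin n, p i.succ = if S i then q i else p i.castSucc)
    (hxq : ∀ i, x i ≤ q i) (hqx : ∀ i, q i ≤ 2 * x i) :
    let c := ∑ i, if S i ∧ ∀ i', i < i' → ¬ S i' then x i else 0
    c ≤ p (Fin.last n) ∧ p (Fin.last n) ≤ 2 * c ∧
      (∑ i, if S i then x i - p i.castSucc else 0) ≤ c := by
  induction n with
  | zero => simp [hp0]
  | succ n ih =>
    obtain ⟨h₁, h₂, h₃⟩ := ih (fun i => S i.castSucc) (fun i => x i.castSucc)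
      (fun i => q i.castSucc) (fun i => p i.castSucc) hp0
      (fun i => hp i.castSucc) (fun i => hxq _) (fun i => hqx _)
    have hlast := hp (Fin.last n)
    have hx := hxq (Fin.last n)
    have hq := hqx (Fin.last n)
    simp only [Fin.sum_univ_castSucc, Fin.forall_fin_succ', Fin.castSucc_lt_castSucc_iff,
      Fin.castSucc_lt_last, forall_true_left, lt_irrefl, (Fin.castSucc_lt_last _).not_gt,
      IsEmpty.forall_iff, implies_true, and_true, Fin.succ_last] at h₁ h₂ h₃ hlast ⊢
    by_cases hS : S (Fin.last n)
    · simp only [hS, if_true, not_true_eq_false, and_false, if_false,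
        Finset.sum_const_zero] at hlast ⊢
      refine ⟨?_, ?_, ?_⟩ <;> linarith
    · simp only [hS, if_false, not_false_eq_true, and_true, add_zero] at hlast ⊢
      rw [hlast]
      exact ⟨h₁, h₂, h₃⟩

/-- In a demand set, every item's supporting value is at least its price. -/
theorem IsDemand.price_le_support {m : ℕ} {v : Val m} {p a : Fin m → ℝ} {M B : Finset (Fin m)}
    (hB : IsDemand v p M B) (ha : IsSupport v B a) {j : Fin m} (hj : j ∈ B) : p j ≤ a j := by
  have hd := hB.2 (B.erase j) ((Finset.erase_subset _ _).trans hB.1)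
  have hs := ha.2.2.1 (B.erase j)
  have he := ha.2.2.2
  have hpj := Finset.add_sum_erase B p hj
  have haj := Finset.add_sum_erase B a hj
  linarith

/-- Disjoint bundles cost no more in total than all items together. -/
theorem IsAlloc.sum_sum_le {n m : ℕ} {O : Fin n → Finset (Fin m)} (hO : IsAlloc O)
    {p : Fin m → ℝ} (hp : ∀ j, 0 ≤ p j) : ∑ i, ∑ j ∈ O i, p j ≤ ∑ j, p j := by
  rw [← Finset.sum_biUnion fun i _ i' _ h => hO i i' h]
  exact Finset.sum_le_univ_sum_of_nonneg hp

/-- The modified buyer-wise greedy algorithm, in which prices are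
raised to the least power of two above the supporting value, is a `3`-approximation to
the optimal offline welfare for XOS valuations.  The run of the algorithm is described
by the demand sets `A i` chosen for the buyers, the additive supporting functions
`a i` of `v i` on `A i`, and the price trajectories `p`: prices start at `0`, buyer
`i` takes a demand set `A i` at the prices `p i.castSucc` over all items (re-assigning
items taken from earlier buyers), and the price of every `j ∈ A i` is raised to
`min {2^k : k ∈ ℤ, 2^k ≥ a i j}`.  Buyer `i` finally keeps `A i` minus everything
re-assigned to later buyers. -/
theorem stmt4 {n m : ℕ} (v : Fin n → Val m)
    (hv : ∀ i, IsValuation (v i) ∧ IsXOS (v i))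
    (A : Fin n → Finset (Fin m)) (a : Fin n → Fin m → ℝ)
    (p : Fin (n + 1) → Fin m → ℝ)
    (hp0 : ∀ j, p 0 j = 0)
    (hdem : ∀ i, IsDemand (v i) (p i.castSucc) Finset.univ (A i))
    (hsupp : ∀ i, IsSupport (v i) (A i) (a i))
    (hupd : ∀ (i : Fin n) (j : Fin m),
      p i.succ j = if j ∈ A i then pow2ceil (a i j) else p i.castSucc j) :
    OPT v ≤ 3 * ∑ i, v i (A i \ (Finset.univ.filter fun i' => i < i').biUnion A) := by
  have : Nonempty {A : Fin n → Finset (Fin m) // IsAlloc A} :=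
    ⟨⟨fun _ => ∅, fun _ _ _ => Finset.disjoint_empty_left _⟩⟩
  refine ciSup_le fun ⟨O, hO⟩ => ?_
  have hmono (j : Fin m) : Monotone fun k => p k j := by
    refine Fin.monotone_iff_le_succ.2 fun i => ?_
    rw [hupd i j]
    split_ifs with h
    · exact ((hdem i).price_le_support (hsupp i) h).trans (le_pow2ceil _)
    · exact le_rfl
  have hnonneg (j : Fin m) : 0 ≤ p (Fin.last n) j := hp0 j ▸ hmono j (Fin.zero_le _)
  have hitem (j : Fin m) := price_history_bounds (fun i => j ∈ A i) (fun i => a i j)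
    (fun i => pow2ceil (a i j)) (fun k => p k j) (hp0 j) (fun i => hupd i j)
    (fun i => le_pow2ceil _) (fun i => pow2ceil_le_two_mul ((hsupp i).1 j))
  have hbuyer (i : Fin n) : v i (O i) ≤
      (∑ j, if j ∈ A i then a i j - p i.castSucc j else 0) + ∑ j ∈ O i, p (Fin.last n) j := by
    have hd := (hdem i).2 (O i) (Finset.subset_univ _)
    have hle : ∑ j ∈ O i, p i.castSucc j ≤ ∑ j ∈ O i, p (Fin.last n) j :=
      Finset.sum_le_sum fun j _ => hmono j (Fin.le_last _)
    rw [Finset.sum_ite_mem, Finset.univ_inter, Finset.sum_sub_distrib, (hsupp i).2.2.2]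
    linarith
  have hkept (i : Fin n) :
      (∑ j, if j ∈ A i ∧ ∀ i', i < i' → j ∉ A i' then a i j else 0) ≤
        v i (A i \ (Finset.univ.filter fun i' => i < i').biUnion A) := by
    refine le_trans (le_of_eq ?_) ((hsupp i).2.2.1 _)
    rw [← Finset.sum_filter]
    congr 1
    ext j
    simp
  calc ∑ i, v i (O i)
      ≤ (∑ i, ∑ j, if j ∈ A i then a i j - p i.castSucc j else 0)
          + ∑ i, ∑ j ∈ O i, p (Fin.last n) j := by
        rw [← Finset.sum_add_distrib]
        exact Finset.sum_le_sum fun i _ => hbuyer i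
    _ ≤ (∑ j, ∑ i, if j ∈ A i then a i j - p i.castSucc j else 0)
          + ∑ j, p (Fin.last n) j := by
        rw [Finset.sum_comm]
        gcongr
        exact hO.sum_sum_le hnonneg
    _ ≤ ∑ j, 3 * ∑ i, if j ∈ A i ∧ ∀ i', i < i' → j ∉ A i' then a i j else 0 := by
        rw [← Finset.sum_add_distrib]
        refine Finset.sum_le_sum fun j _ => ?_
        obtain ⟨-, h₂, h₃⟩ := hitem j
        linarith
    _ = 3 * ∑ i, ∑ j, if j ∈ A i ∧ ∀ i', i < i' → j ∉ A i' then a i j else 0 := by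
        rw [← Finset.mul_sum, Finset.sum_comm]
    _ ≤ _ := by
        gcongr with i
        exact hkept i
end

section
/- For a generic distribution D over valuation profiles, the function p ↦ π(p) = (π_1(p),…,π_m(p)) mapping a price vector to the vector of probabilities that each item is sold by the sequential posted-price mechanism at prices p is continuous, and for each item j the function p_j ↦ π_j(p_j, p_{−j}) is weakly decreasing in p_j. -/
open scoped BigOperators

open MeasureTheory
open scoped ENNReal

variable {n m : ℕ}

/-- The set of items still available after the first `i` buyers have bought, in the
sequential posted-price mechanism at prices `q`, where buyer `i` (with valuation
`v i`) buys the bundle `sel i (v i) q M` from the available items `M`. -/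
def availN (sel : Fin n → Val m → (Fin m → ℝ) → Finset (Fin m) → Finset (Fin m))
    (q : Fin m → ℝ) (v : Fin n → Val m) : ℕ → Finset (Fin m)
  | 0 => Finset.univ
  | i + 1 =>
      if h : i < n then
        availN sel q v i \ sel ⟨i, h⟩ (v ⟨i, h⟩) q (availN sel q v i)
      else availN sel q v i

/-- The set of items sold by the sequential posted-price mechanism. -/
def soldSet (sel : Fin n → Val m → (Fin m → ℝ) → Finset (Fin m) → Finset (Fin m))
    (q : Fin m → ℝ) (v : Fin n → Val m) : Finset (Fin m) :=
  Finset.univ \ availN sel q v n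

/-- The bundle bought by buyer `i` in the sequential posted-price mechanism. -/
def buys (sel : Fin n → Val m → (Fin m → ℝ) → Finset (Fin m) → Finset (Fin m))
    (q : Fin m → ℝ) (v : Fin n → Val m) (i : Fin n) : Finset (Fin m) :=
  sel i (v i) q (availN sel q v i.1)

/-- A distribution over single valuations is generic: for every price vector and every
set of available items, with probability zero there exist two distinct demand sets. -/
def Generic1 {m : ℕ} (D : Measure (Val m)) : Prop :=
  ∀ (q : Fin m → ℝ) (M : Finset (Fin m)),
    D {v : Val m | ∃ B1 B2 : Finset (Fin m),
      B1 ≠ B2 ∧ IsDemand v q M B1 ∧ IsDemand v q M B2} = 0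

/-- A joint distribution over valuation profiles is generic: each buyer's marginal is
generic. -/
def Generic {n m : ℕ} (D : Measure (Fin n → Val m)) : Prop :=
  ∀ (i : Fin n) (q : Fin m → ℝ) (M : Finset (Fin m)),
    D {v : Fin n → Val m | ∃ B1 B2 : Finset (Fin m),
      B1 ≠ B2 ∧ IsDemand (v i) q M B1 ∧ IsDemand (v i) q M B2} = 0

open Filter Topology

/-- If every buyer selects the same bundles at two price vectors, the same items remain
available. -/
lemma availN_congr {sel : Fin n → Val m → (Fin m → ℝ) → Finset (Fin m) → Finset (Fin m)}
    {q q' : Fin m → ℝ} {v : Fin n → Val m}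
    (h : ∀ i M, sel i (v i) q M = sel i (v i) q' M) (k : ℕ) :
    availN sel q v k = availN sel q' v k := by
  induction k with
  | zero => rfl
  | succ k ih => simp only [availN, ih, h]

/-- The profiles at which, for buyer `i`, available set `M` and prices `q`, the bundle `B₁` is
demanded while `B₂` is within `δ` of being demanded. -/
def nearTie (q : Fin m → ℝ) (i : Fin n) (M B₁ B₂ : Finset (Fin m)) (δ : ℝ) :
    Set (Fin n → Val m) :=
  {v | B₁ ≠ B₂ ∧ B₂ ⊆ M ∧ IsDemand (v i) q M B₁ ∧
    v i B₁ - ∑ j ∈ B₁, q j ≤ v i B₂ - ∑ j ∈ B₂, q j + δ}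

lemma measurableSet_nearTie (q : Fin m → ℝ) (i : Fin n) (M B₁ B₂ : Finset (Fin m)) (δ : ℝ) :
    MeasurableSet (nearTie q i M B₁ B₂ δ) := by
  have hm : ∀ B : Finset (Fin m), Measurable fun v : Fin n → Val m => v i B := fun B =>
    (measurable_pi_apply B).comp (measurable_pi_apply i)
  have hdem : MeasurableSet {v : Fin n → Val m | ∀ B' ⊆ M,
      v i B' - ∑ j ∈ B', q j ≤ v i B₁ - ∑ j ∈ B₁, q j} := by
    simp only [Set.ofPred_forall]
    exact MeasurableSet.iInter fun B' => MeasurableSet.iInter fun _ =>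
      measurableSet_le ((hm B').sub_const _) ((hm B₁).sub_const _)
  exact (MeasurableSet.const _).inter <| (MeasurableSet.const _).inter <|
    ((MeasurableSet.const _).inter hdem).inter <|
      measurableSet_le ((hm B₁).sub_const _) (((hm B₂).sub_const _).add_const _)

lemma Generic.tendsto_measure_nearTie {D : Measure (Fin n → Val m)} [IsFiniteMeasure D]
    (hgen : Generic D) (q : Fin m → ℝ) (i : Fin n) (M B₁ B₂ : Finset (Fin m)) :
    Tendsto (fun k : ℕ => D (nearTie q i M B₁ B₂ (1 / ((k : ℝ) + 1)))) atTop (𝓝 0) := by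
  have hanti : Antitone fun k : ℕ =>
      (nearTie q i M B₁ B₂ (1 / ((k : ℝ) + 1)) : Set (Fin n → Val m)) := by
    rintro a b hab v ⟨hne, hsub, hdem, hle⟩
    exact ⟨hne, hsub, hdem, hle.trans (by gcongr)⟩
  have hnull : D (⋂ k : ℕ, nearTie q i M B₁ B₂ (1 / ((k : ℝ) + 1))) = 0 := by
    refine measure_mono_null (fun v hv => ?_) (hgen i q M)
    rw [Set.mem_iInter] at hv
    obtain ⟨hne, hsub, hdem, -⟩ := hv 0
    refine ⟨B₁, B₂, hne, hdem, hsub, fun B' hB' => (hdem.2 B' hB').trans ?_⟩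
    have hlim : Tendsto (fun k : ℕ => v i B₂ - ∑ j ∈ B₂, q j + 1 / ((k : ℝ) + 1)) atTop
        (𝓝 (v i B₂ - ∑ j ∈ B₂, q j + 0)) :=
      tendsto_const_nhds.add tendsto_one_div_add_atTop_nhds_zero_nat
    rw [add_zero] at hlim
    exact ge_of_tendsto' hlim fun k => (hv k).2.2.2
  rw [← hnull]
  exact tendsto_measure_iInter_atTop
    (fun k => (measurableSet_nearTie q i M B₁ B₂ _).nullMeasurableSet) hanti
    ⟨0, measure_ne_top _ _⟩

/-- For generic `D`, near ties at `q` within a small enough `δ` have arbitrarily small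
probability, uniformly over buyers and bundles. -/
lemma Generic.exists_measure_nearTie_le {D : Measure (Fin n → Val m)} [IsFiniteMeasure D]
    (hgen : Generic D) (q : Fin m → ℝ) {ε : ℝ≥0∞} (hε : 0 < ε) :
    ∃ δ > 0, D {v | ∃ i M B₁ B₂, v ∈ nearTie q i M B₁ B₂ δ} ≤ ε := by
  have hsum : Tendsto (fun k : ℕ =>
      ∑ t : Fin n × Finset (Fin m) × Finset (Fin m) × Finset (Fin m),
        D (nearTie q t.1 t.2.1 t.2.2.1 t.2.2.2 (1 / ((k : ℝ) + 1)))) atTop (𝓝 0) := by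
    simpa using tendsto_finsetSum
      (Finset.univ : Finset (Fin n × Finset (Fin m) × Finset (Fin m) × Finset (Fin m)))
      fun t _ => hgen.tendsto_measure_nearTie q t.1 t.2.1 t.2.2.1 t.2.2.2
  obtain ⟨k, hk⟩ := (hsum.eventually_lt_const hε).exists
  refine ⟨1 / ((k : ℝ) + 1), by positivity, ?_⟩
  refine (measure_mono ?_).trans ((measure_iUnion_fintype_le D _).trans hk.le)
  rintro v ⟨i, M, B₁, B₂, hv⟩
  exact Set.mem_iUnion.2 ⟨(i, M, B₁, B₂), hv⟩

/-- Away from near ties, a small change of the prices does not change what is sold. -/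
lemma soldSet_eq_of_forall_notMem_nearTie
    {sel : Fin n → Val m → (Fin m → ℝ) → Finset (Fin m) → Finset (Fin m)}
    (hsel : ∀ i v q M, IsDemand v q M (sel i v q M)) {q q' : Fin m → ℝ} {δ : ℝ}
    (hq : ∀ B : Finset (Fin m), |∑ j ∈ B, q' j - ∑ j ∈ B, q j| < δ / 2) {v : Fin n → Val m}
    (hv : ¬ ∃ i M B₁ B₂, v ∈ nearTie q i M B₁ B₂ δ) :
    soldSet sel q' v = soldSet sel q v := by
  have hagree : ∀ i M, sel i (v i) q' M = sel i (v i) q M := by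
    intro i M
    by_contra hne
    have hq₁ := abs_lt.1 (hq (sel i (v i) q M))
    have hq₂ := abs_lt.1 (hq (sel i (v i) q' M))
    have hle := (hsel i (v i) q' M).2 _ (hsel i (v i) q M).1
    exact hv ⟨i, M, _, _, Ne.symm hne, (hsel i (v i) q' M).1, hsel i (v i) q M, by linarith⟩
  rw [soldSet, soldSet, availN_congr hagree]

lemma Generic.tendsto_measure_mem_soldSet {D : Measure (Fin n → Val m)} [IsFiniteMeasure D]
    (hgen : Generic D)
    {sel : Fin n → Val m → (Fin m → ℝ) → Finset (Fin m) → Finset (Fin m)}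
    (hsel : ∀ i v q M, IsDemand v q M (sel i v q M)) (q : Fin m → ℝ) (j : Fin m) :
    Tendsto (fun q' => D {v | j ∈ soldSet sel q' v}) (𝓝 q) (𝓝 (D {v | j ∈ soldSet sel q v})) := by
  rw [ENNReal.tendsto_nhds (measure_ne_top _ _)]
  intro ε hε
  obtain ⟨δ, hδ, hD⟩ := hgen.exists_measure_nearTie_le q hε
  have hnear : ∀ᶠ q' in 𝓝 q, ∀ B : Finset (Fin m),
      |∑ j ∈ B, q' j - ∑ j ∈ B, q j| < δ / 2 := by
    refine eventually_all.2 fun B => ?_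
    have hc : Continuous fun q' : Fin m → ℝ => |∑ j ∈ B, q' j - ∑ j ∈ B, q j| := by fun_prop
    exact hc.continuousAt.eventually_lt_const (by simpa using hδ)
  filter_upwards [hnear] with q' hq'
  have hsold := fun v hv =>
    soldSet_eq_of_forall_notMem_nearTie (v := v) hsel hq' hv
  have key : ∀ s t : Set (Fin n → Val m),
      (∀ v, (¬ ∃ i M B₁ B₂, v ∈ nearTie q i M B₁ B₂ δ) → v ∈ s → v ∈ t) → D s ≤ D t + ε := by
    intro s t hst
    refine (measure_mono fun v hv => ?_).trans
      ((measure_union_le t {v | ∃ i M B₁ B₂, v ∈ nearTie q i M B₁ B₂ δ}).trans (by gcongr))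
    by_cases h : ∃ i M B₁ B₂, v ∈ nearTie q i M B₁ B₂ δ
    · exact Or.inr h
    · exact Or.inl (hst v h hv)
  refine ⟨tsub_le_iff_right.2 (key _ _ fun v hv => ?_), key _ _ fun v hv => ?_⟩
  · simp only [Set.mem_ofPred_eq, hsold v hv, imp_self]
  · simp only [Set.mem_ofPred_eq, hsold v hv, imp_self]

/-- A bundle without `j` that is demanded at the lower price of `j` is also demanded at the
higher price. -/
lemma IsDemand.update_of_le {v : Val m} {q : Fin m → ℝ} {j : Fin m} {x y : ℝ} (hxy : x ≤ y)
    {M B : Finset (Fin m)} (hB : IsDemand v (Function.update q j x) M B) (hj : j ∉ B) :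
    IsDemand v (Function.update q j y) M B := by
  refine ⟨hB.1, fun B' hB' => ?_⟩
  have h := hB.2 B' hB'
  rw [Finset.sum_update_of_notMem hj] at h ⊢
  by_cases hj' : j ∈ B'
  · rw [Finset.sum_update_of_mem hj'] at h ⊢
    linarith
  · rwa [Finset.sum_update_of_notMem hj'] at h ⊢

lemma availN_succ_subset (sel : Fin n → Val m → (Fin m → ℝ) → Finset (Fin m) → Finset (Fin m))
    (q : Fin m → ℝ) (v : Fin n → Val m) (k : ℕ) :
    availN sel q v (k + 1) ⊆ availN sel q v k := by
  rw [availN]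
  split_ifs
  · exact Finset.sdiff_subset
  · exact subset_rfl

/-- As long as `j` is unsold at its lower price `x`, the higher price `y` leads to the same
available items, provided demand sets at price `y` are unique. -/
lemma availN_update_eq {sel : Fin n → Val m → (Fin m → ℝ) → Finset (Fin m) → Finset (Fin m)}
    (hsel : ∀ i v q M, IsDemand v q M (sel i v q M)) {q : Fin m → ℝ} {j : Fin m} {x y : ℝ}
    (hxy : x ≤ y) {v : Fin n → Val m}
    (huniq : ∀ i M B₁ B₂, IsDemand (v i) (Function.update q j y) M B₁ →
      IsDemand (v i) (Function.update q j y) M B₂ → B₁ = B₂) (k : ℕ)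
    (hk : j ∈ availN sel (Function.update q j x) v k) :
    availN sel (Function.update q j y) v k = availN sel (Function.update q j x) v k := by
  induction k with
  | zero => rfl
  | succ k ih =>
    specialize ih (availN_succ_subset _ _ _ _ hk)
    rw [availN] at hk
    rw [availN, availN, ih]
    split_ifs at hk ⊢ with h
    · have hj := (Finset.mem_sdiff.1 hk).2
      rw [huniq _ _ _ _ (hsel _ _ _ _) ((hsel _ _ _ _).update_of_le hxy hj)]
    · rfl

/-- For a generic distribution `D` over valuation profiles, the map
`p ↦ π(p)` sending a (nonnegative) price vector to the vector of probabilities with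
which each item is sold by the sequential posted-price mechanism at prices `p` is
continuous (on the set of nonnegative price vectors), and for each item `j` the
probability `π_j` is weakly decreasing in the price `p_j` of item `j`. -/
theorem stmt11 (D : Measure (Fin n → Val m)) [IsProbabilityMeasure D]
    (hgen : Generic D)
    (sel : Fin n → Val m → (Fin m → ℝ) → Finset (Fin m) → Finset (Fin m))
    (hsel : ∀ i v q M, IsDemand v q M (sel i v q M)) :
    ContinuousOn
      (fun q : Fin m → ℝ => fun j : Fin m =>
        (D {v : Fin n → Val m | j ∈ soldSet sel q v}).toReal)
      {q : Fin m → ℝ | ∀ j, 0 ≤ q j} ∧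
    ∀ (j : Fin m) (q : Fin m → ℝ), (∀ j', 0 ≤ q j') → ∀ x y : ℝ, 0 ≤ x → x ≤ y →
      D {v : Fin n → Val m | j ∈ soldSet sel (Function.update q j y) v} ≤
        D {v : Fin n → Val m | j ∈ soldSet sel (Function.update q j x) v} := by
  refine ⟨?_, fun j q _ x y _ hxy => ?_⟩
  · refine continuousOn_pi.2 fun j q _ => ?_
    exact ((ENNReal.tendsto_toReal (measure_ne_top _ _)).comp
      (hgen.tendsto_measure_mem_soldSet hsel q j)).mono_left nhdsWithin_le_nhds
  · have huniq : ∀ᵐ v ∂D, ∀ i M, ¬ ∃ B₁ B₂ : Finset (Fin m), B₁ ≠ B₂ ∧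
        IsDemand (v i) (Function.update q j y) M B₁ ∧
        IsDemand (v i) (Function.update q j y) M B₂ :=
      ae_all_iff.2 fun i => ae_all_iff.2 fun M => measure_eq_zero_iff_ae_notMem.1 (hgen i _ M)
    refine measure_mono_ae ?_
    filter_upwards [huniq] with v hv hy
    change j ∈ soldSet sel _ v at hy
    change j ∈ soldSet sel _ v
    simp only [soldSet, Finset.mem_sdiff, Finset.mem_univ, true_and] at hy ⊢
    intro hx
    refine hy ?_
    rwa [availN_update_eq hsel hxy (fun i M B₁ B₂ h₁ h₂ => ?_) n hx]
    by_contra hne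
    exact hv i M ⟨B₁, B₂, hne, h₁, h₂⟩
end

section
/- For any generic distribution D over valuation profiles there exists a vector of (1/2)-median prices: a price vector p ∈ ℝ_+^m such that π_j(p) ≤ 1/2 for every item j and π_j(p) ≥ 1/2 for every item j with p_j > 0. -/
open scoped BigOperators

open MeasureTheory
open scoped ENNReal

variable {n m : ℕ}

section Brouwer

open Set Metric
open scoped NNReal Polynomial

variable {E : Type*} [NormedAddCommGroup E]

/-- The determinant of `1 + t • A` is recovered at `t = 1` by Lagrange interpolation. -/
theorem det_one_add_eq_sum_lagrange [NormedSpace ℝ E] [FiniteDimensional ℝ E]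
    (s : Finset ℕ) (v : ℕ → ℝ) (hv : Set.InjOn v s) (hs : Module.finrank ℝ E < s.card)
    (A : E →L[ℝ] E) :
    (1 + A).det = ∑ i ∈ s, (Lagrange.basis s v i).eval 1 * (1 + v i • A).det := by
  classical
  let b := Module.finBasis ℝ E
  let M := LinearMap.toMatrix b b (A : E →ₗ[ℝ] E)
  let P : ℝ[X] := Matrix.det ((Polynomial.X : ℝ[X]) • M.map Polynomial.C
    + (1 : Matrix _ _ ℝ).map Polynomial.C)
  have hP : ∀ t : ℝ, P.eval t = (1 + t • A).det := by
    intro t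
    have h1 : (1 + t • A).det = Matrix.det (1 + t • M) := by
      rw [ContinuousLinearMap.det, ← LinearMap.det_toMatrix b]
      congr 1
      have : ((1 + t • A : E →L[ℝ] E) : E →ₗ[ℝ] E) = LinearMap.id + t • (A : E →ₗ[ℝ] E) := by
        ext x; simp
      rw [this, map_add, map_smul, LinearMap.toMatrix_id]
    rw [h1, ← Polynomial.coe_evalRingHom, RingHom.map_det]
    congr 1
    ext i j
    by_cases hij : i = j <;> simp [hij, add_comm, mul_comm t]
  have hdeg : P.degree < s.card := by
    refine lt_of_le_of_lt Polynomial.degree_le_natDegree ?_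
    have := Polynomial.natDegree_det_X_add_C_le M (1 : Matrix _ _ ℝ)
    rw [Fintype.card_fin] at this
    exact_mod_cast lt_of_le_of_lt this hs
  have h := congrArg (Polynomial.eval 1) (Lagrange.eq_interpolate hv hdeg)
  rw [hP, one_smul] at h
  rw [h, Lagrange.interpolate_apply, Polynomial.eval_finsetSum]
  refine Finset.sum_congr rfl fun i _ => ?_
  rw [Polynomial.eval_mul, Polynomial.eval_C, hP, mul_comm]

/-- Truncating a Lipschitz map that vanishes on a sphere to the inside of the sphere keeps it
Lipschitz. -/
theorem LipschitzWith.indicator_ball [NormedSpace ℝ E] {F : Type*} [NormedAddCommGroup F]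
    {k : E → F} {C : ℝ≥0} (hk : LipschitzWith C k) {r : ℝ}
    (h0 : ∀ x, ‖x‖ = r → k x = 0) : LipschitzWith C ((ball (0 : E) r).indicator k) := by
  have key : ∀ x y : E, ‖x‖ < r → r ≤ ‖y‖ → dist (k x) 0 ≤ C * dist x y := by
    intro x y hx hy
    have hcont : ContinuousOn (fun z : E => ‖z‖) (segment ℝ x y) := continuous_norm.continuousOn
    obtain ⟨z, hz, hzr⟩ := (convex_segment x y).isPreconnected.intermediate_value
      (left_mem_segment ℝ x y) (right_mem_segment ℝ x y) hcont ⟨hx.le, hy⟩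
    rw [← h0 z hzr]
    refine (hk.dist_le_mul x z).trans ?_
    gcongr
    have := dist_add_dist_of_mem_segment hz
    linarith [dist_nonneg (x := z) (y := y)]
  refine LipschitzWith.of_dist_le_mul fun x y => ?_
  by_cases hx : ‖x‖ < r <;> by_cases hy : ‖y‖ < r
  · simpa [indicator, hx, hy] using hk.dist_le_mul x y
  · simpa [indicator, hx, hy] using key x y hx (not_lt.1 hy)
  · have := key y x hy (not_lt.1 hx)
    simpa [indicator, hx, hy, dist_comm] using this
  · simp [indicator, hx, hy]
    positivity

/-- A small Lipschitz perturbation of the identity supported in a ball maps the ball onto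
itself. -/
theorem image_ball_id_add [NormedSpace ℝ E] [CompleteSpace E]
    {k : E → E} {c : ℝ≥0} (hc : c < 1) (hk : LipschitzWith c k)
    {r : ℝ} (h0 : ∀ x, r ≤ ‖x‖ → k x = 0) :
    Function.Injective (fun x => x + k x) ∧
      (fun x => x + k x) '' ball (0 : E) r = ball (0 : E) r := by
  have hinj : Function.Injective (fun x => x + k x) := by
    intro x y hxy
    have h1 : x - y = k y - k x := by
      have : x + k x = y + k y := hxy
      rw [sub_eq_sub_iff_add_eq_add, this, add_comm]
    have h2 := hk.dist_le_mul y x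
    rw [dist_eq_norm, ← h1, dist_comm, dist_eq_norm] at h2
    by_contra hne
    have hpos : 0 < ‖x - y‖ := norm_pos_iff.2 (sub_ne_zero.2 hne)
    have hc' : (c : ℝ) < 1 := by exact_mod_cast hc
    nlinarith
  have hsurj : Function.Surjective (fun x => x + k x) := by
    intro y
    have hcon : ContractingWith c (fun x => y - k x) := by
      refine ⟨hc, LipschitzWith.of_dist_le_mul fun a b => ?_⟩
      rw [dist_sub_left]
      exact hk.dist_le_mul a b
    refine ⟨hcon.fixedPoint, ?_⟩
    have := hcon.fixedPoint_isFixedPt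
    have h : y - k hcon.fixedPoint = hcon.fixedPoint := this
    simp only
    nth_rewrite 1 [← h]
    simp
  refine ⟨hinj, Subset.antisymm ?_ ?_⟩
  · rintro _ ⟨x, hx, rfl⟩
    by_contra hout
    have hout' : r ≤ ‖x + k x‖ := by simpa using hout
    have h1 : (fun x => x + k x) (x + k x) = (fun x => x + k x) x := by
      simp [h0 _ hout']
    have h2 := hinj h1
    rw [h2] at hout'
    exact absurd (mem_ball_zero_iff.1 hx) (not_lt.2 hout')
  · intro y hy
    obtain ⟨x, hx⟩ := hsurj y
    refine ⟨x, ?_, hx⟩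
    by_contra hout
    have hout' : r ≤ ‖x‖ := by simpa using hout
    simp only [h0 x hout', add_zero] at hx
    exact hout (hx ▸ hy)

variable [MeasurableSpace E] [BorelSpace E]

theorem setIntegral_det_one_add_smul [NormedSpace ℝ E] [FiniteDimensional ℝ E]
    (μ : Measure E) [μ.IsAddHaarMeasure] {k : E → E} {C : ℝ≥0} (hk : LipschitzWith C k) {r : ℝ}
    (h0 : ∀ x, r ≤ ‖x‖ → k x = 0) {A : E → E →L[ℝ] E}
    (hA : ∀ x ∈ ball (0 : E) r, HasFDerivAt k (A x) x) :
    ∃ δ > 0, ∀ t : ℝ, 0 ≤ t → t < δ →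
      ∫ x in ball (0 : E) r, (1 + t • A x).det ∂μ = μ.real (ball 0 r) := by
  have hdet : Continuous fun B : E →L[ℝ] E => B.det := ContinuousLinearMap.continuous_det
  have hev : ∀ᶠ B in nhds (1 : E →L[ℝ] E), 0 < B.det := by
    apply hdet.continuousAt.eventually_const_lt
    have : (1 : E →L[ℝ] E).det = 1 := by simp [ContinuousLinearMap.det]
    change (0 : ℝ) < (1 : E →L[ℝ] E).det
    rw [this]
    exact one_pos
  obtain ⟨ε, hε, hεB⟩ := Metric.eventually_nhds_iff.1 hev
  refine ⟨min 1 ε / (C + 1), by positivity, fun t ht0 htδ => ?_⟩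
  have hC : (0 : ℝ) ≤ C := C.2
  have htC : t * (C + 1) < min 1 ε := (lt_div_iff₀ (by positivity)).1 htδ
  have htC1 : t * C < 1 := by nlinarith [min_le_left 1 ε]
  have htCε : t * C < ε := by nlinarith [min_le_right 1 ε]
  have hlip : LipschitzWith (t.toNNReal * C) (fun x => t • k x) := by
    refine LipschitzWith.of_dist_le_mul fun x y => ?_
    rw [dist_smul₀, Real.norm_of_nonneg ht0, NNReal.coe_mul, Real.coe_toNNReal t ht0,
      mul_assoc]
    exact mul_le_mul_of_nonneg_left (hk.dist_le_mul x y) ht0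
  obtain ⟨hinj, himg⟩ := image_ball_id_add (r := r) 
    (by rw [← NNReal.coe_lt_coe]; simpa [ht0] using htC1) hlip
    (fun x hx => by simp [h0 x hx])
  have hder : ∀ x ∈ ball (0 : E) r,
      HasFDerivWithinAt (fun x => x + t • k x) (1 + t • A x) (ball 0 r) x := fun x hx =>
    ((hasFDerivAt_id x).add ((hA x hx).const_smul t)).hasFDerivWithinAt
  have hcv := integral_image_eq_integral_abs_det_fderiv_smul μ measurableSet_ball hder
    hinj.injOn (fun _ => (1 : ℝ))
  rw [himg] at hcv
  simp only [integral_const, smul_eq_mul, mul_one, measureReal_restrict_apply_univ] at hcv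
  rw [hcv]
  refine setIntegral_congr_fun measurableSet_ball fun x hx => ?_
  have hAC : ‖A x‖ ≤ C := (hA x hx).le_of_lipschitz hk
  refine (abs_of_pos (hεB ?_)).symm
  rw [dist_eq_norm, add_sub_cancel_left, norm_smul, Real.norm_of_nonneg ht0]
  exact lt_of_le_of_lt (mul_le_mul_of_nonneg_left hAC ht0) htCε

theorem setIntegral_det_one_add [NormedSpace ℝ E] [FiniteDimensional ℝ E]
    (μ : Measure E) [μ.IsAddHaarMeasure] {k : E → E} {C : ℝ≥0} (hk : LipschitzWith C k) {r : ℝ}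
    (h0 : ∀ x, r ≤ ‖x‖ → k x = 0) {A : E → E →L[ℝ] E} (hAc : Continuous A)
    (hA : ∀ x ∈ ball (0 : E) r, HasFDerivAt k (A x) x) :
    ∫ x in ball (0 : E) r, (1 + A x).det ∂μ = μ.real (ball 0 r) := by
  obtain ⟨δ, hδ, hintegral⟩ := setIntegral_det_one_add_smul μ hk h0 hA
  have hdet : Continuous fun B : E →L[ℝ] E => B.det := ContinuousLinearMap.continuous_det
  let s := Finset.range (Module.finrank ℝ E + 1)
  let v : ℕ → ℝ := fun i => δ / (i + 2)
  have hv : Set.InjOn v s := by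
    intro i _ j _ hij
    have hij' : δ / ((i : ℝ) + 2) = δ / (j + 2) := hij
    rw [div_eq_div_iff (by positivity) (by positivity)] at hij'
    have := mul_left_cancel₀ hδ.ne' hij'
    exact_mod_cast (add_right_cancel this).symm
  have hs : Module.finrank ℝ E < s.card := by simp [s]
  have hI : ∀ t : ℝ, IntegrableOn (fun x => (1 + t • A x).det) (ball (0 : E) r) μ := fun t =>
    ((hdet.comp (continuous_const.add (hAc.const_smul t))).continuousOn.integrableOn_compact
      (isCompact_closedBall (0 : E) r)).mono_set ball_subset_closedBall
  rw [funext fun x => det_one_add_eq_sum_lagrange s v hv hs (A x)]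
  rw [integral_finsetSum _ fun i _ => (hI (v i)).const_mul _]
  have : ∀ i ∈ s, ∫ x in ball (0 : E) r, (Lagrange.basis s v i).eval 1 * (1 + v i • A x).det ∂μ
      = (Lagrange.basis s v i).eval 1 * μ.real (ball 0 r) := by
    intro i _
    rw [integral_const_mul, hintegral (v i) (by positivity)]
    exact div_lt_self hδ (by linarith [(Nat.cast_nonneg i : (0 : ℝ) ≤ i)])
  rw [Finset.sum_congr rfl this, ← Finset.sum_mul, ← Polynomial.eval_finsetSum,
    Lagrange.sum_basis hv ⟨0, by simp [s]⟩]
  simp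

/-- A compactly supported `C¹` map has a fixed point: otherwise normalizing `x - h x` would give a
retraction of a ball onto its boundary, whose Jacobian determinant vanishes identically. -/
theorem exists_fixedPoint_of_contDiff_of_hasCompactSupport [InnerProductSpace ℝ E]
    [FiniteDimensional ℝ E] {h : E → E} (hh : ContDiff ℝ 1 h) (hsupp : HasCompactSupport h) :
    ∃ x, h x = x := by
  by_contra! hne
  obtain ⟨r, hr, hsub⟩ := hsupp.isCompact.isBounded.subset_ball_lt 0 (0 : E)
  have hout : ∀ x, r ≤ ‖x‖ → h x = 0 := fun x hx => by
    by_contra hx0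
    exact absurd (mem_ball_zero_iff.1 (hsub (subset_tsupport h hx0))) (not_lt.2 hx)
  have hG : ∀ x, x - h x ≠ 0 := fun x hx => hne x (sub_eq_zero.1 hx).symm
  have hGc : ContDiff ℝ 1 fun x => x - h x := contDiff_id.sub hh
  let N : E → E := fun x => ‖x - h x‖⁻¹ • (x - h x)
  have hN : ContDiff ℝ 1 N :=
    ((hGc.norm ℝ hG).inv fun x => norm_ne_zero_iff.2 (hG x)).smul hGc
  have hN1 : ∀ x, ‖N x‖ = 1 := fun x => by
    simp [N, norm_smul, inv_mul_cancel₀ (norm_ne_zero_iff.2 (hG x))]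
  let u : E → E := fun x => r • N x - x
  have hu : ContDiff ℝ 1 u := (hN.const_smul r).sub contDiff_id
  let χ : ContDiffBump (0 : E) := ⟨r, 2 * r, hr, by linarith⟩
  have hχ : ∀ x : E, ‖x‖ ≤ r → χ x = 1 := fun x hx =>
    χ.one_of_mem_closedBall (by simpa using hx)
  obtain ⟨C, hC⟩ := ContDiff.lipschitzWith_of_hasCompactSupport (𝕂 := ℝ)
    (f := fun x => χ x • u x) χ.hasCompactSupport.smul_right (χ.contDiff.smul hu) one_ne_zero
  have hsphere : ∀ x : E, ‖x‖ = r → χ x • u x = 0 := fun x hx => by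
    simp [u, N, hout x hx.ge, hx, smul_smul, mul_inv_cancel₀ hr.ne']
  have hder : ∀ x ∈ ball (0 : E) r,
      HasFDerivAt ((ball (0 : E) r).indicator fun x => χ x • u x) (fderiv ℝ u x) x := by
    intro x hx
    refine ((hu.differentiable one_ne_zero) x).hasFDerivAt.congr_of_eventuallyEq ?_
    filter_upwards [isOpen_ball.mem_nhds hx] with y hy
    rw [indicator_of_mem hy, hχ y (mem_ball_zero_iff.1 hy).le, one_smul]
  have hvol := setIntegral_det_one_add (Measure.addHaar : Measure E) (hC.indicator_ball hsphere)
    (fun x hx => indicator_of_notMem (by simpa using hx) _) (hu.continuous_fderiv one_ne_zero)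
    hder
  have hzero : ∀ x, (1 + fderiv ℝ u x).det = 0 := by
    intro x
    have hNd : HasFDerivAt N (fderiv ℝ N x) x :=
      (hN.differentiable one_ne_zero x).hasFDerivAt
    have h1 : 1 + fderiv ℝ u x = r • fderiv ℝ N x := by
      have : HasFDerivAt u (r • fderiv ℝ N x - 1) x :=
        (hNd.const_smul r).sub (hasFDerivAt_id x)
      rw [this.fderiv]; abel
    have horth : ∀ w, inner ℝ (N x) (fderiv ℝ N x w) = 0 := by
      intro w
      have h2 : HasFDerivAt (fun y => ‖N y‖ ^ 2) (2 • (innerSL ℝ (N x)).comp (fderiv ℝ N x)) x :=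
        hNd.norm_sq
      have h3 : (fun y => ‖N y‖ ^ 2) = fun _ => (1 : ℝ) := by
        funext y; rw [hN1, one_pow]
      rw [h3] at h2
      have h4 := congrArg (fun L : E →L[ℝ] ℝ => L w) (h2.unique (hasFDerivAt_const (1 : ℝ) x))
      simpa using h4
    by_contra hdet
    rw [h1] at hdet
    have hsurj : Function.Surjective (r • fderiv ℝ N x) :=
      (LinearMap.equivOfDetNeZero ((r • fderiv ℝ N x : E →L[ℝ] E) : E →ₗ[ℝ] E) hdet).surjective
    obtain ⟨w, hw⟩ := hsurj (N x)
    have h5 : inner ℝ (N x) ((r • fderiv ℝ N x) w) = 0 := by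
      simp [inner_smul_right, horth]
    rw [hw, real_inner_self_eq_norm_sq, hN1] at h5
    norm_num at h5
  simp only [hzero, integral_zero] at hvol
  exact (ENNReal.toReal_pos (measure_ball_pos _ _ hr).ne' measure_ball_lt_top.ne).ne hvol

/-- **Brouwer's fixed point theorem** for a continuous map with bounded range. -/
theorem exists_fixedPoint_of_continuous_of_bounded [InnerProductSpace ℝ E]
    [FiniteDimensional ℝ E] {g : E → E} (hg : Continuous g) {R : ℝ} (hR : ∀ x, ‖g x‖ ≤ R) :
    ∃ x, g x = x := by
  have hR0 : 0 ≤ R := (norm_nonneg _).trans (hR 0)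
  have happrox : ∀ ε : ℝ, 0 < ε → ε ≤ 1 → ∃ x ∈ closedBall (0 : E) (R + 1), dist (g x) x ≤ ε := by
    intro ε hε hε1
    obtain ⟨f, hf, hfg, -⟩ := hg.exists_contDiff_approx 1 (ε := fun _ => ε) continuous_const
      fun _ => hε
    have hfR : ∀ x, ‖f x‖ ≤ R + 1 := fun x => by
      have := norm_le_norm_add_norm_sub (g x) (f x)
      rw [← dist_eq_norm, dist_comm] at this
      linarith [hR x, hfg x]
    let χ : ContDiffBump (0 : E) := ⟨R + 1, R + 2, by linarith, by linarith⟩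
    obtain ⟨x, hx⟩ := exists_fixedPoint_of_contDiff_of_hasCompactSupport
      (h := fun x => χ x • f x) (χ.contDiff.smul hf) χ.hasCompactSupport.smul_right
    have hxR : ‖x‖ ≤ R + 1 := by
      rw [← hx, norm_smul, Real.norm_of_nonneg χ.nonneg]
      nlinarith [χ.le_one (x := x), χ.nonneg (x := x), hfR x, norm_nonneg (f x)]
    have hxB : x ∈ closedBall (0 : E) (R + 1) := by simpa using hxR
    have hfx : f x = x := by
      have : χ x = 1 := χ.one_of_mem_closedBall hxB
      simpa [this] using hx
    refine ⟨x, hxB, ?_⟩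
    have := hfg x
    rw [hfx, dist_comm] at this
    exact this.le
  obtain ⟨x, hxB, hmin⟩ := (isCompact_closedBall (0 : E) (R + 1)).exists_isMinOn
    ⟨0, by simp; linarith⟩ (hg.dist continuous_id).continuousOn
  refine ⟨x, dist_le_zero.1 (le_of_forall_pos_le_add fun ε hε => ?_)⟩
  obtain ⟨y, hyB, hy⟩ := happrox (min ε 1) (by positivity) (min_le_right _ _)
  have h1 : dist (g x) x ≤ dist (g y) y := hmin hyB
  linarith [min_le_left ε 1]

end Brouwer

section Mechanism

open Filter Topology

/-- The profiles for which every buyer has a unique demand set at prices `q`, whatever the set of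
available items. -/
def uniqueDemand (q : Fin m → ℝ) : Set (Fin n → Val m) :=
  {v | ∀ i M B₁ B₂, IsDemand (v i) q M B₁ → IsDemand (v i) q M B₂ → B₁ = B₂}

theorem Generic.ae_uniqueDemand {D : Measure (Fin n → Val m)} (hgen : Generic D)
    (q : Fin m → ℝ) : ∀ᵐ v ∂D, v ∈ uniqueDemand q := by
  have h : ∀ᵐ v ∂D, ∀ (i : Fin n) (M : Finset (Fin m)), ¬ ∃ B1 B2 : Finset (Fin m),
      B1 ≠ B2 ∧ IsDemand (v i) q M B1 ∧ IsDemand (v i) q M B2 := by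
    rw [ae_all_iff]
    intro i
    rw [ae_all_iff]
    intro M
    simpa [ae_iff] using hgen i q M
  filter_upwards [h] with v hv i M B₁ B₂ h₁ h₂
  by_contra hne
  exact hv i M ⟨B₁, B₂, hne, h₁, h₂⟩

theorem measurableSet_isDemand (i : Fin n) (q : Fin m → ℝ) (M B : Finset (Fin m)) :
    MeasurableSet {v : Fin n → Val m | IsDemand (v i) q M B} := by
  have : {v : Fin n → Val m | IsDemand (v i) q M B} =
      {_v | B ⊆ M} ∩ ⋂ B', ⋂ (_ : B' ⊆ M),
        {v | v i B' - ∑ j ∈ B', q j ≤ v i B - ∑ j ∈ B, q j} := by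
    ext v; simp [IsDemand]
  rw [this]
  refine (MeasurableSet.const _).inter (MeasurableSet.iInter fun B' => MeasurableSet.iInter
    fun _ => measurableSet_le ?_ ?_) <;> fun_prop

/-- A unique demand set stays a demand set, and the only one, at nearby prices. -/
theorem eventually_eq_of_isDemand {v : Val m} {q : Fin m → ℝ} {M B : Finset (Fin m)}
    (hB : IsDemand v q M B) (huniq : ∀ B', IsDemand v q M B' → B' = B) :
    ∀ᶠ q' in 𝓝 q, ∀ B', IsDemand v q' M B' → B' = B := by
  rw [eventually_all]
  intro B'
  by_cases hne : B' = B
  · exact Eventually.of_forall fun _ _ => hne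
  by_cases hM : B' ⊆ M
  · have hlt : v B' - ∑ j ∈ B', q j < v B - ∑ j ∈ B, q j := by
      by_contra hge
      exact hne (huniq B' ⟨hM, fun A hA => (hB.2 A hA).trans (not_lt.1 hge)⟩)
    have hopen : IsOpen {q' : Fin m → ℝ | v B' - ∑ j ∈ B', q' j < v B - ∑ j ∈ B, q' j} :=
      isOpen_lt (by fun_prop) (by fun_prop)
    filter_upwards [hopen.mem_nhds hlt] with q' hq' hdem
    exact absurd (hdem.2 B hB.1) (not_le.2 hq')
  · exact Eventually.of_forall fun _ h => absurd h.1 hM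

variable {sel : Fin n → Val m → (Fin m → ℝ) → Finset (Fin m) → Finset (Fin m)}

theorem eventually_availN_eq (hsel : ∀ i v q M, IsDemand v q M (sel i v q M))
    {q : Fin m → ℝ} {v : Fin n → Val m} (hv : v ∈ uniqueDemand q) (k : ℕ) :
    ∀ᶠ q' in 𝓝 q, availN sel q' v k = availN sel q v k := by
  induction k with
  | zero => exact Eventually.of_forall fun _ => rfl
  | succ k ih =>
    by_cases hk : k < n
    · filter_upwards [ih, eventually_eq_of_isDemand
        (hsel ⟨k, hk⟩ (v ⟨k, hk⟩) q (availN sel q v k))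
        fun B' hB' => hv ⟨k, hk⟩ _ _ _ hB' (hsel _ _ _ _)] with q' h₁ h₂
      simp only [availN, hk, dif_pos, h₁]
      rw [h₂ _ (hsel _ _ _ _)]
    · filter_upwards [ih] with q' h₁
      simpa only [availN, hk, dif_neg, not_false_eq_true] using h₁

theorem nullMeasurableSet_sel {D : Measure (Fin n → Val m)} (hgen : Generic D)
    (hsel : ∀ i v q M, IsDemand v q M (sel i v q M)) (q : Fin m → ℝ) (i : Fin n)
    (M B : Finset (Fin m)) :
    NullMeasurableSet {v : Fin n → Val m | sel i (v i) q M = B} D := by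
  refine (measurableSet_isDemand i q M B).nullMeasurableSet.congr ?_
  filter_upwards [hgen.ae_uniqueDemand q] with v hv
  exact propext ⟨fun h => hv i M _ _ (hsel _ _ _ _) h, fun h => h ▸ hsel _ _ _ _⟩

theorem nullMeasurableSet_availN {D : Measure (Fin n → Val m)} (hgen : Generic D)
    (hsel : ∀ i v q M, IsDemand v q M (sel i v q M)) (q : Fin m → ℝ) (k : ℕ)
    (M : Finset (Fin m)) :
    NullMeasurableSet {v : Fin n → Val m | availN sel q v k = M} D := by
  induction k generalizing M with
  | zero => exact (MeasurableSet.const (Finset.univ = M)).nullMeasurableSet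
  | succ k ih =>
    by_cases hk : k < n
    · have : {v : Fin n → Val m | availN sel q v (k + 1) = M} =
          ⋃ A : Finset (Fin m), ⋃ B : Finset (Fin m), ⋃ (_ : A \ B = M),
            {v | availN sel q v k = A} ∩ {v | sel ⟨k, hk⟩ (v ⟨k, hk⟩) q A = B} := by
        ext v
        simp only [availN, hk, dif_pos, Set.mem_ofPred_eq, Set.mem_iUnion, Set.mem_inter_iff,
          exists_prop]
        constructor
        · exact fun h => ⟨_, _, h, rfl, rfl⟩
        · rintro ⟨A, B, h, rfl, rfl⟩
          exact h
      rw [this]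
      exact NullMeasurableSet.iUnion fun A => NullMeasurableSet.iUnion fun B =>
        NullMeasurableSet.iUnion fun _ => (ih A).inter (nullMeasurableSet_sel hgen hsel q _ A B)
    · simpa only [availN, hk, dif_neg, not_false_eq_true] using ih M

theorem nullMeasurableSet_sold {D : Measure (Fin n → Val m)} (hgen : Generic D)
    (hsel : ∀ i v q M, IsDemand v q M (sel i v q M)) (q : Fin m → ℝ) (j : Fin m) :
    NullMeasurableSet {v : Fin n → Val m | j ∈ soldSet sel q v} D := by
  have : {v : Fin n → Val m | j ∈ soldSet sel q v} =
      ⋃ M : Finset (Fin m), ⋃ (_ : j ∉ M), {v | availN sel q v n = M} := by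
    ext v; simp [soldSet]
  rw [this]
  exact NullMeasurableSet.iUnion fun M => NullMeasurableSet.iUnion fun _ =>
    nullMeasurableSet_availN hgen hsel q n M

/-- The sale probability of an item is a continuous function of the prices. -/
theorem continuous_measureReal_sold {D : Measure (Fin n → Val m)} [IsProbabilityMeasure D]
    (hgen : Generic D) (hsel : ∀ i v q M, IsDemand v q M (sel i v q M)) (j : Fin m) :
    Continuous fun q => D.real {v : Fin n → Val m | j ∈ soldSet sel q v} := by
  have hintegral : ∀ q, D.real {v : Fin n → Val m | j ∈ soldSet sel q v} =
      ∫ v, {v : Fin n → Val m | j ∈ soldSet sel q v}.indicator (fun _ => (1 : ℝ)) v ∂D := by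
    intro q
    rw [integral_indicator₀ (nullMeasurableSet_sold hgen hsel q j)]
    simp
  simp_rw [hintegral]
  rw [continuous_iff_continuousAt]
  intro q
  refine continuousAt_of_dominated (bound := fun _ => 1)
    (Eventually.of_forall fun q' => ?_) (Eventually.of_forall fun q' => ae_of_all _ fun v => ?_)
    (integrable_const 1) ?_
  · exact aestronglyMeasurable_const.indicator₀ (nullMeasurableSet_sold hgen hsel q' j)
  · by_cases h : j ∈ soldSet sel q' v <;> simp [h]
  · filter_upwards [hgen.ae_uniqueDemand q] with v hv
    refine continuousAt_const.congr (f := fun _ =>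
      {v : Fin n → Val m | j ∈ soldSet sel q v}.indicator (fun _ => (1 : ℝ)) v) ?_
    filter_upwards [eventually_availN_eq hsel hv n] with q' hq'
    simp [Set.indicator, soldSet, hq']

theorem exists_mem_sel_of_notMem_availN {q : Fin m → ℝ} {v : Fin n → Val m} {j : Fin m} {k : ℕ}
    (h : j ∉ availN sel q v k) : ∃ i M, j ∈ sel i (v i) q M := by
  induction k with
  | zero => simp [availN] at h
  | succ k ih =>
    by_cases hk : k < n
    · by_cases hj : j ∈ availN sel q v k
      · refine ⟨⟨k, hk⟩, availN sel q v k, ?_⟩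
        simpa [availN, hk, hj] using h
      · exact ih hj
    · exact ih (by simpa [availN, hk] using h)

/-- An item can only be sold at a price bounded by the total size of the valuations. -/
theorem price_le_of_mem_soldSet (hsel : ∀ i v q M, IsDemand v q M (sel i v q M))
    {q : Fin m → ℝ} {v : Fin n → Val m} {j : Fin m} (h : j ∈ soldSet sel q v) :
    q j ≤ 2 * ∑ i, ∑ B, |v i B| := by
  obtain ⟨i, M, hj⟩ := exists_mem_sel_of_notMem_availN (by simpa [soldSet] using h)
  obtain ⟨hBM, hB⟩ := hsel i (v i) q M
  have h₁ := hB _ ((Finset.erase_subset j _).trans hBM)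
  rw [← Finset.add_sum_erase _ _ hj] at h₁
  have hle : ∀ B, |v i B| ≤ ∑ i, ∑ B, |v i B| := fun B =>
    (Finset.single_le_sum (f := fun B => |v i B|) (fun _ _ => abs_nonneg _)
      (Finset.mem_univ B)).trans
    (Finset.single_le_sum (f := fun i => ∑ B, |v i B|)
      (fun _ _ => Finset.sum_nonneg fun _ _ => abs_nonneg _) (Finset.mem_univ i))
  have h₂ := hle (sel i (v i) q M)
  have h₃ := hle ((sel i (v i) q M).erase j)
  linarith [le_abs_self (v i (sel i (v i) q M)), neg_abs_le (v i ((sel i (v i) q M).erase j))]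

theorem exists_price_bound (D : Measure (Fin n → Val m)) [IsProbabilityMeasure D]
    (hsel : ∀ i v q M, IsDemand v q M (sel i v q M)) :
    ∃ K : ℝ, 0 < K ∧ ∀ (q : Fin m → ℝ) (j : Fin m), K ≤ q j →
      D.real {v : Fin n → Val m | j ∈ soldSet sel q v} < 1 / 2 := by
  let s : ℕ → Set (Fin n → Val m) := fun k => {v | (k : ℝ) ≤ 2 * ∑ i, ∑ B, |v i B|}
  have hs : ∀ k, MeasurableSet (s k) := fun k =>
    measurableSet_le measurable_const (by fun_prop)
  have hanti : Antitone s := fun a b hab v hv =>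
    le_trans (by exact_mod_cast hab) (show (b : ℝ) ≤ _ from hv)
  have hempty : ⋂ k, s k = ∅ := by
    refine Set.eq_empty_of_forall_notMem fun v hv => ?_
    obtain ⟨k, hk⟩ := exists_nat_gt (2 * ∑ i, ∑ B, |v i B|)
    exact absurd (show (k : ℝ) ≤ _ from Set.mem_iInter.1 hv k) (not_le.2 hk)
  have htend := tendsto_measure_iInter_atTop (μ := D) (fun k => (hs k).nullMeasurableSet) hanti
    ⟨0, measure_ne_top _ _⟩
  rw [hempty, measure_empty] at htend
  have hev := htend.eventually_lt_const (show (0 : ℝ≥0∞) < ENNReal.ofReal (1 / 2) by simp)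
  obtain ⟨k, hk, hk0⟩ := (hev.and (eventually_gt_atTop 0)).exists
  refine ⟨k, by exact_mod_cast hk0, fun q j hq => ?_⟩
  have hsub : {v : Fin n → Val m | j ∈ soldSet sel q v} ⊆ s k := fun v hv =>
    hq.trans (price_le_of_mem_soldSet hsel hv)
  refine lt_of_le_of_lt (measureReal_mono hsub) ?_
  exact (ENNReal.toReal_lt_of_lt_ofReal hk)

end Mechanism

/-- For continuous excess demand `f` that is negative at high prices there are equilibrium prices,
that is, a solution of the nonlinear complementarity problem. -/
theorem exists_complementarity_solution {ι : Type*} [Fintype ι] (f : ι → (ι → ℝ) → ℝ)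
    (hf : ∀ j, Continuous (f j)) {K : ℝ} (hK : 0 < K) (hneg : ∀ j p, K ≤ p j → f j p < 0) :
    ∃ p : ι → ℝ, (∀ j, 0 ≤ p j) ∧ ∀ j, f j p ≤ 0 ∧ (0 < p j → f j p = 0) := by
  let g : EuclideanSpace ℝ ι → EuclideanSpace ℝ ι := fun x =>
    WithLp.toLp 2 fun j => max 0 (min K (x j + f j x.ofLp))
  have hg : Continuous g := by
    refine (PiLp.continuous_toLp 2 _).comp (continuous_pi fun j => ?_)
    have := (hf j).comp (PiLp.continuous_ofLp 2 (fun _ : ι => ℝ))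
    exact continuous_const.max (continuous_const.min
      (((continuous_apply j).comp (PiLp.continuous_ofLp 2 (fun _ : ι => ℝ))).add this))
  have hbound : ∀ x, ‖g x‖ ≤ √(∑ _j : ι, K ^ 2) := by
    intro x
    rw [EuclideanSpace.norm_eq]
    refine Real.sqrt_le_sqrt (Finset.sum_le_sum fun j _ => ?_)
    have h0 : 0 ≤ g x j := le_max_left _ _
    have h1 : g x j ≤ K := max_le hK.le (min_le_left _ _)
    rw [Real.norm_of_nonneg h0]
    gcongr
  obtain ⟨x, hx⟩ := exists_fixedPoint_of_continuous_of_bounded hg hbound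
  have hxj : ∀ j, max 0 (min K (x j + f j x.ofLp)) = x j := fun j =>
    congrArg (fun y : EuclideanSpace ℝ ι => y j) hx
  refine ⟨x.ofLp, fun j => hxj j ▸ le_max_left _ _, fun j => ?_⟩
  have hj := hxj j
  have hlt : x j < K := by
    by_contra hge
    have := hneg j x.ofLp (not_lt.1 hge)
    have h1 : x j ≤ K := hj ▸ max_le hK.le (min_le_left _ _)
    have : max 0 (min K (x j + f j x.ofLp)) < K :=
      max_lt hK ((min_le_right _ _).trans_lt (by linarith))
    linarith [not_lt.1 hge]
  have hmin : min K (x j + f j x.ofLp) = x j + f j x.ofLp := by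
    refine min_eq_right (le_of_not_gt fun h => ?_)
    rw [min_eq_left h.le, max_eq_right hK.le] at hj
    exact hlt.ne hj.symm
  rw [hmin] at hj
  refine ⟨by linarith [le_max_right 0 (x j + f j x.ofLp)], fun hpos => ?_⟩
  rcases max_choice 0 (x j + f j x.ofLp) with h | h <;> rw [h] at hj
  · exact absurd hj hpos.ne
  · linarith

/-- For any generic distribution `D` over valuation profiles there
exists a vector of `(1/2)`-median prices: a nonnegative price vector `p` such that
every item is sold by the sequential posted-price mechanism at prices `p` with
probability at most `1/2`, and every item of positive price is sold with probability
at least `1/2`. -/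
theorem stmt12 (D : Measure (Fin n → Val m)) [IsProbabilityMeasure D]
    (hgen : Generic D)
    (sel : Fin n → Val m → (Fin m → ℝ) → Finset (Fin m) → Finset (Fin m))
    (hsel : ∀ i v q M, IsDemand v q M (sel i v q M)) :
    ∃ p : Fin m → ℝ, (∀ j, 0 ≤ p j) ∧
      ∀ j : Fin m,
        D {v : Fin n → Val m | j ∈ soldSet sel p v} ≤ (1 / 2 : ℝ≥0∞) ∧
        (0 < p j →
          (1 / 2 : ℝ≥0∞) ≤ D {v : Fin n → Val m | j ∈ soldSet sel p v}) := by
  obtain ⟨K, hK, hneg⟩ := exists_price_bound D hsel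
  obtain ⟨p, hp0, hp⟩ := exists_complementarity_solution
    (fun j q => D.real {v : Fin n → Val m | j ∈ soldSet sel q v} - 1 / 2)
    (fun j => (continuous_measureReal_sold hgen hsel j).sub continuous_const) hK
    (fun j q hq => sub_neg.2 (hneg q j hq))
  have hhalf : (1 / 2 : ℝ≥0∞) = ENNReal.ofReal (1 / 2) := by
    rw [ENNReal.ofReal_div_of_pos two_pos]; simp
  refine ⟨p, hp0, fun j => ⟨?_, fun hpos => ?_⟩⟩
  · rw [hhalf, ← ofReal_measureReal]
    exact ENNReal.ofReal_le_ofReal (sub_nonpos.1 (hp j).1)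
  · rw [hhalf, ← ofReal_measureReal]
    exact ENNReal.ofReal_le_ofReal (sub_eq_zero.1 ((hp j).2 hpos)).ge
end
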